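/- arXiv:1102.1628 — 2 statements merged into one kernel-verified Lean document; each statement's English description precedes it below -/
import Mathlib

section
/- Let α be irrational and a root of the primitive integer polynomial px² + qx + r with p > 0, and let D = q² − 4pr. If integers a, b, c, d satisfy ad − bc = ±1 and cα² + (d−a)α − b = 0, then there exists an integer m with c = mp, d − a = mq, −b = mr, and setting x = a + d, y = m we have x² − Dy² = 4(ad − bc). -/
theorem lin_zero (α : ℝ) (hirr : Irrational α) (A B : ℤ)
    (h : (A : ℝ) * α + B = 0) : A = 0 ∧ B = 0 := by
  have hA : A = 0 := by
    by_contra hA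
    apply hirr
    have hA' : (A : ℝ) ≠ 0 := by exact_mod_cast hA
    refine ⟨(-B : ℚ) / A, ?_⟩
    push_cast
    rw [div_eq_iff hA']
    linarith
  subst hA
  refine ⟨rfl, ?_⟩
  simpa using h

theorem stabilizer_gives_pell_solution (α : ℝ) (hirr : Irrational α)
    (p q r : ℤ) (hp : 0 < p) (hprim : Int.gcd p (Int.gcd q r) = 1)
    (hroot : (p : ℝ) * α ^ 2 + q * α + r = 0)
    (D : ℤ) (hD : D = q ^ 2 - 4 * p * r)
    (a b c d : ℤ) (hdet : a * d - b * c = 1 ∨ a * d - b * c = -1)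
    (hquad : (c : ℝ) * α ^ 2 + ((d : ℝ) - a) * α - b = 0) :
    ∃ m : ℤ, c = m * p ∧ d - a = m * q ∧ -b = m * r ∧
      (a + d) ^ 2 - D * m ^ 2 = 4 * (a * d - b * c) := by
  obtain ⟨h1, h2⟩ := lin_zero α hirr (p * (d - a) - c * q) (-(p * b) - c * r) (by
    push_cast
    linear_combination (p : ℝ) * hquad - (c : ℝ) * hroot)
  have e1 := Int.gcd_eq_gcd_ab p (Int.gcd q r)
  have e2 := Int.gcd_eq_gcd_ab q r
  rw [hprim] at e1
  generalize Int.gcdA p (Int.gcd q r) = u at e1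
  generalize Int.gcdB p (Int.gcd q r) = v at e1
  rw [e2] at e1
  generalize Int.gcdA q r = s at e1
  generalize Int.gcdB q r = t at e1
  push_cast at e1
  obtain ⟨m, hm⟩ : ∃ m, c = m * p :=
    ⟨c * u + (d - a) * s * v - b * t * v, by
      linear_combination c * e1 - s * v * h1 - t * v * h2⟩
  have hq : d - a = m * q := by
    apply mul_left_cancel₀ hp.ne'
    linear_combination h1 + q * hm
  have hr : -b = m * r := by
    apply mul_left_cancel₀ hp.ne'
    linear_combination h2 + r * hm
  refine ⟨m, hm, hq, hr, ?_⟩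
  subst hD
  linear_combination (d - a + m * q) * hq - 4 * c * hr - 4 * m * r * hm
end

section
/- Two positive real numbers α and β have eventually equal continued fraction expansions (i.e., there exist k, N such that the n-th partial quotient of α equals the (n+k)-th partial quotient of β for all n ≥ N) if and only if there exist integers a, b, c, d with ad − bc = ±1, cα + d > 0, and β = (aα + b)/(cα + d). -/
/-- The `n`-th partial quotient of the continued fraction expansion of `α`,
computed by the Gauss map algorithm: `a₀ = ⌊α⌋`, and the remaining partial
quotients are those of `1 / fract α`. -/
noncomputable def partialQuotient : ℝ → ℕ → ℤ
  | α, 0 => ⌊α⌋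
  | α, n + 1 => partialQuotient (Int.fract α)⁻¹ n

/-- Gauss map step. -/
noncomputable def gaussT (x : ℝ) : ℝ := (Int.fract x)⁻¹

theorem pq_eq (x : ℝ) (n : ℕ) : partialQuotient x n = ⌊gaussT^[n] x⌋ := by
  induction n generalizing x with
  | zero => simp [partialQuotient]
  | succ n ih => rw [partialQuotient, ih, Function.iterate_succ_apply]; rfl

theorem pq_add (x : ℝ) (n k : ℕ) :
    partialQuotient x (n + k) = partialQuotient (gaussT^[k] x) n := by
  rw [pq_eq, pq_eq, Function.iterate_add_apply]

/-- Having a common tail. -/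
def TailRel (x y : ℝ) : Prop := ∃ k l : ℕ, gaussT^[k] x = gaussT^[l] y

theorem TailRel.symm {x y : ℝ} (h : TailRel x y) : TailRel y x := by
  obtain ⟨k, l, h⟩ := h
  exact ⟨l, k, h.symm⟩

theorem TailRel.trans {x y z : ℝ} (h : TailRel x y) (h' : TailRel y z) : TailRel x z := by
  obtain ⟨k, l, h⟩ := h
  obtain ⟨m, n, h'⟩ := h'
  refine ⟨m + k, l + n, ?_⟩
  rw [Function.iterate_add_apply, h, ← Function.iterate_add_apply, Nat.add_comm m l,
    Function.iterate_add_apply, h', ← Function.iterate_add_apply]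

theorem TailRel.add_int (x : ℝ) (m : ℤ) : TailRel x (x + m) :=
  ⟨1, 1, by simp [gaussT]⟩

theorem TailRel.inv_lt {x : ℝ} (h0 : 0 < x) (h1 : x < 1) : TailRel x x⁻¹ :=
  ⟨1, 0, by simp [gaussT, Int.fract_eq_self.2 ⟨h0.le, h1⟩]⟩

theorem TailRel.inv_pos {x : ℝ} (h0 : 0 < x) : TailRel x x⁻¹ := by
  rcases lt_trichotomy x 1 with h | h | h
  · exact TailRel.inv_lt h0 h
  · subst h; exact ⟨0, 0, by simp⟩
  · have := TailRel.inv_lt (_root_.inv_pos.2 h0) (inv_lt_one_of_one_lt₀ h)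
    rw [inv_inv] at this
    exact this.symm

theorem TailRel.one_sub {f : ℝ} (h0 : 0 < f) (h1 : f < 1) : TailRel (1 - f) f := by
  have h2 : 0 < 1 - f := by linarith
  have a1 := TailRel.inv_pos h2
  have a2 := TailRel.add_int (1 - f)⁻¹ (-1)
  have e : (1 - f)⁻¹ + ((-1 : ℤ) : ℝ) = (f⁻¹ + ((-1 : ℤ) : ℝ))⁻¹ := by
    have e1 : f⁻¹ + ((-1 : ℤ) : ℝ) = (1 - f) / f := by
      push_cast; field_simp; ring
    rw [e1, inv_div]
    push_cast; field_simp; ring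
  rw [e] at a2
  have h3 : 0 < f⁻¹ + ((-1 : ℤ) : ℝ) := by
    have := (one_lt_inv₀ h0).2 h1
    push_cast; linarith
  exact ((a1.trans a2).trans (TailRel.inv_pos h3).symm).trans
    ((TailRel.add_int f⁻¹ (-1)).symm.trans (TailRel.inv_pos h0).symm)

theorem TailRel.neg (x : ℝ) : TailRel x (-x) := by
  have hx : x = Int.fract x + (⌊x⌋ : ℤ) := (Int.fract_add_floor x).symm
  have a1 := (TailRel.add_int (Int.fract x) ⌊x⌋).symm
  rw [← hx] at a1
  rcases (Int.fract_nonneg x).eq_or_lt with h | h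
  · rw [← h, zero_add] at hx
    have : -x = x + ((-2 * ⌊x⌋ : ℤ) : ℝ) := by
      push_cast; linarith
    rw [this]; exact TailRel.add_int _ _
  · have a2 := (TailRel.one_sub h (Int.fract_lt_one x)).symm
    have a3 := TailRel.add_int (1 - Int.fract x) (-⌊x⌋ - 1)
    have : 1 - Int.fract x + ((-⌊x⌋ - 1 : ℤ) : ℝ) = -x := by
      push_cast; linarith
    rw [this] at a3
    exact a1.trans (a2.trans a3)

theorem TailRel.inv (x : ℝ) : TailRel x x⁻¹ := by
  rcases lt_trichotomy x 0 with h | h | h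
  · have := TailRel.inv_pos (neg_pos.2 h)
    rw [inv_neg] at this
    exact (TailRel.neg x).trans (this.trans (TailRel.neg _).symm)
  · subst h; exact ⟨0, 0, by simp⟩
  · exact TailRel.inv_pos h

theorem lin_ne_zero {x : ℝ} (hx : Irrational x) {a b c d : ℤ}
    (h : a * d - b * c = 1 ∨ a * d - b * c = -1) : (c : ℝ) * x + d ≠ 0 := by
  intro h0
  by_cases hc : c = 0
  · subst hc
    have : d = 0 := by simpa using h0
    subst this
    simp at h
  · have hc' : (c : ℝ) ≠ 0 := by exact_mod_cast hc
    refine hx ⟨-d / c, ?_⟩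
    push_cast
    field_simp
    linarith

theorem tail_of_moebius (n : ℕ) (x : ℝ) (hx : Irrational x) : ∀ (a b c d : ℤ), c.natAbs = n →
    (a * d - b * c = 1 ∨ a * d - b * c = -1) →
    TailRel x (((a : ℝ) * x + b) / ((c : ℝ) * x + d)) := by
  induction n using Nat.strong_induction_on with
  | _ n ih =>
  intro a b c d hn hdet
  have hx0 : (c : ℝ) * x + d ≠ 0 := lin_ne_zero hx hdet
  by_cases hc : c = 0
  · subst hc
    simp only [mul_zero, sub_zero] at hdet
    have hd : d = 1 ∨ d = -1 := by
      apply Int.isUnit_iff.1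
      rcases hdet with h | h
      · exact IsUnit.of_mul_eq_one a (by linarith)
      · exact IsUnit.of_mul_eq_one (-a) (by linarith)
    have ha : a = 1 ∨ a = -1 := by
      rcases hd with rfl | rfl <;> omega
    rcases hd with rfl | rfl <;> rcases ha with rfl | rfl
    · simpa using TailRel.add_int x b
    · simpa using (TailRel.neg x).trans (TailRel.add_int (-x) b)
    · have := (TailRel.neg x).trans (TailRel.add_int (-x) (-b))
      convert this using 1; push_cast; ring
    · have := TailRel.add_int x (-b)
      convert this using 1; push_cast; ring
  · have hlt : (a % c).natAbs < n := by
      have h1 := Int.emod_nonneg a hc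
      have h2 := Int.emod_lt_abs a hc
      rw [Int.abs_eq_natAbs] at h2
      omega
    have hr : a % c = a - c * (a / c) := by
      have := Int.emod_add_mul_ediv a c; linarith
    have key := ih _ hlt c d (a % c) (b - (a / c) * d) rfl (by
      rw [hr]
      rcases hdet with h | h
      · right; linear_combination -h
      · left; linear_combination -h)
    have k2 := (key.trans (TailRel.inv _)).trans (TailRel.add_int _ (a / c))
    convert k2 using 1
    rw [inv_div, hr, div_add' _ _ _ hx0]
    congr 1
    push_cast
    ring

/-- Moebius relation, cleared of denominators. -/
def MobRel (x y : ℝ) : Prop := ∃ a b c d : ℤ, (a * d - b * c = 1 ∨ a * d - b * c = -1) ∧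
  y * (c * x + d) = a * x + b

theorem MobRel.symm {x y : ℝ} (h : MobRel x y) : MobRel y x := by
  obtain ⟨a, b, c, d, hd, h⟩ := h
  refine ⟨-d, b, c, -a, ?_, ?_⟩
  · rcases hd with h | h
    · left; linarith
    · right; linarith
  · push_cast; linear_combination h

theorem MobRel.step {x y : ℝ} (hy : Irrational y) (h : MobRel x y) : MobRel x (gaussT y) := by
  obtain ⟨a, b, c, d, hd, h⟩ := h
  have hf : Int.fract y ≠ 0 := by
    intro h0
    exact hy ⟨⌊y⌋, by have := Int.fract_add_floor y; rw [h0] at this; push_cast; linarith⟩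
  refine ⟨c, d, a - ⌊y⌋ * c, b - ⌊y⌋ * d, ?_, ?_⟩
  · rcases hd with h | h
    · right; linear_combination -h
    · left; linear_combination -h
  · have e : (a : ℝ) * x + b = (Int.fract y + ⌊y⌋) * (c * x + d) := by
      rw [Int.fract_add_floor, h]
    have : ((a - ⌊y⌋ * c : ℤ) : ℝ) * x + ((b - ⌊y⌋ * d : ℤ) : ℝ) = Int.fract y * (c * x + d) := by
      push_cast; linear_combination e
    rw [this, gaussT, inv_mul_cancel_left₀ hf]

theorem MobRel.trans {x y z : ℝ} (h : MobRel x y) (h' : MobRel y z) : MobRel x z := by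
  obtain ⟨a, b, c, d, hd, h⟩ := h
  obtain ⟨a', b', c', d', hd', h'⟩ := h'
  refine ⟨a' * a + b' * c, a' * b + b' * d, c' * a + d' * c, c' * b + d' * d, ?_, ?_⟩
  · have : (a' * a + b' * c) * (c' * b + d' * d) - (a' * b + b' * d) * (c' * a + d' * c)
      = (a' * d' - b' * c') * (a * d - b * c) := by ring
    rw [this]
    rcases hd with h | h <;> rcases hd' with h' | h' <;> simp [h, h']
  · push_cast
    linear_combination (c * x + d) * h' + (a' - z * c') * h

theorem irr_gaussT {x : ℝ} (hx : Irrational x) : Irrational (gaussT x) := by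
  have : Irrational (x - (⌊x⌋ : ℤ)) := hx.sub_intCast _
  exact this.inv

theorem irr_iter {x : ℝ} (hx : Irrational x) (k : ℕ) : Irrational (gaussT^[k] x) := by
  induction k with
  | zero => simpa
  | succ k ih => rw [Function.iterate_succ_apply']; exact irr_gaussT ih

theorem mob_iter {x : ℝ} (hx : Irrational x) (k : ℕ) : MobRel x (gaussT^[k] x) := by
  induction k with
  | zero => exact ⟨1, 0, 0, 1, by simp, by simp⟩
  | succ k ih => rw [Function.iterate_succ_apply']; exact ih.step (irr_iter hx k)

theorem fract_pos_irr {x : ℝ} (hx : Irrational x) : 0 < Int.fract x := by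
  refine (Int.fract_nonneg x).lt_of_ne fun h0 => ?_
  exact hx ⟨⌊x⌋, by have := Int.fract_add_floor x; rw [← h0] at this; push_cast; linarith⟩

theorem one_lt_gaussT {x : ℝ} (hx : Irrational x) : 1 < gaussT x :=
  (one_lt_inv₀ (fract_pos_irr hx)).2 (Int.fract_lt_one x)

theorem eq_floor_add {x : ℝ} : x = ⌊x⌋ + (gaussT x)⁻¹ := by
  rw [gaussT, inv_inv, Int.floor_add_fract]

theorem two_le_mul {x : ℝ} (hx : Irrational x) : 2 ≤ gaussT x * gaussT (gaussT x) := by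
  have h1 := one_lt_gaussT hx
  have h2 := one_lt_gaussT (irr_gaussT hx)
  have h3 : gaussT x * gaussT (gaussT x) = ⌊gaussT x⌋ * gaussT (gaussT x) + 1 := by
    have h5 := eq_floor_add (x := gaussT x)
    have h6 : (gaussT (gaussT x))⁻¹ * gaussT (gaussT x) = 1 := inv_mul_cancel₀ (by linarith)
    linear_combination gaussT (gaussT x) * h5 + h6
  have h4 : (1 : ℝ) ≤ ⌊gaussT x⌋ := by
    exact_mod_cast Int.le_floor.2 (by push_cast; exact h1.le)
  rw [h3]; nlinarith

theorem abs_sub_step {x y : ℝ} (hx : Irrational x) (hy : Irrational y) (h : ⌊x⌋ = ⌊y⌋) :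
    |gaussT x - gaussT y| = (gaussT x * gaussT y) * |x - y| := by
  have h1 := one_lt_gaussT hx
  have h2 := one_lt_gaussT hy
  have e : gaussT x - gaussT y = -((gaussT x * gaussT y) * (x - y)) := by
    have e1 : x - y = (gaussT x)⁻¹ - (gaussT y)⁻¹ := by
      have a := eq_floor_add (x := x)
      have b := eq_floor_add (x := y)
      rw [h] at a
      linarith
    rw [e1]; field_simp; ring
  rw [e, abs_neg, abs_mul, abs_of_pos (by positivity)]

theorem abs_bound (n : ℕ) : ∀ {x y : ℝ}, Irrational x → Irrational y →
    (∀ n, partialQuotient x n = partialQuotient y n) → 4 ^ n * |x - y| ≤ 1 := by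
  induction n with
  | zero =>
    intro x y hx hy h
    simpa using (Int.abs_sub_lt_one_of_floor_eq_floor (h 0)).le
  | succ n ih =>
    intro x y hx hy h
    have k := ih (irr_gaussT (irr_gaussT hx)) (irr_gaussT (irr_gaussT hy)) (fun n => h (n + 2))
    rw [abs_sub_step (irr_gaussT hx) (irr_gaussT hy) (h 1), abs_sub_step hx hy (h 0)] at k
    have p := two_le_mul hx
    have q := two_le_mul hy
    refine le_trans ?_ k
    have pq : 4 ≤ (gaussT x * gaussT (gaussT x)) * (gaussT y * gaussT (gaussT y)) := by
      nlinarith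
    calc 4 ^ (n + 1) * |x - y| = (4 ^ n * |x - y|) * 4 := by ring
      _ ≤ (4 ^ n * |x - y|) * ((gaussT x * gaussT (gaussT x)) * (gaussT y * gaussT (gaussT y))) := by
        gcongr
      _ = _ := by ring

theorem eq_of_pq {x y : ℝ} (hx : Irrational x) (hy : Irrational y)
    (h : ∀ n, partialQuotient x n = partialQuotient y n) : x = y := by
  by_contra hne
  have hpos : 0 < |x - y| := abs_pos.2 (sub_ne_zero.2 hne)
  obtain ⟨n, hn⟩ := pow_unbounded_of_one_lt (|x - y|)⁻¹ (by norm_num : (1 : ℝ) < 4)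
  have := abs_bound n hx hy h
  have h2 := mul_lt_mul_of_pos_right hn hpos
  rw [inv_mul_cancel₀ hpos.ne'] at h2
  linarith

theorem eventually_equal_cf_iff_moebius (α β : ℝ) (hα : 0 < α) (hβ : 0 < β)
    (hirrα : Irrational α) (hirrβ : Irrational β) :
    (∃ k l N : ℕ, ∀ n ≥ N, partialQuotient α (n + k) = partialQuotient β (n + l)) ↔
      ∃ a b c d : ℤ, (a * d - b * c = 1 ∨ a * d - b * c = -1) ∧
        (c : ℝ) * α + d > 0 ∧ β = ((a : ℝ) * α + b) / ((c : ℝ) * α + d) := by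
  constructor
  · rintro ⟨k, l, N, h⟩
    have e : gaussT^[N + k] α = gaussT^[N + l] β := by
      refine eq_of_pq (irr_iter hirrα _) (irr_iter hirrβ _) fun n => ?_
      rw [← pq_add, ← pq_add, ← add_assoc, ← add_assoc]
      exact h _ (by omega)
    have m1 := mob_iter hirrα (N + k)
    rw [e] at m1
    obtain ⟨a, b, c, d, hd, hm⟩ := m1.trans (mob_iter hirrβ (N + l)).symm
    have hne := lin_ne_zero hirrα hd
    rcases hne.lt_or_gt with hlt | hgt
    · refine ⟨-a, -b, -c, -d, by simpa using hd, by push_cast; linarith, ?_⟩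
      rw [eq_div_iff (by push_cast; intro h0; apply hne; linarith)]
      push_cast; linarith
    · exact ⟨a, b, c, d, hd, hgt, by rw [eq_div_iff hne]; exact hm⟩
  · rintro ⟨a, b, c, d, hd, -, rfl⟩
    obtain ⟨k, l, h⟩ := tail_of_moebius _ α hirrα a b c d rfl hd
    exact ⟨k, l, 0, fun n _ => by rw [pq_add, pq_add, h]⟩
end
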